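/- For x in a suitable domain (e.g. 0 < x < 1), the quadratic transformation ₂F₁(1/2, 1/2; 1; x) = (1 − 2x)^{−1/2} · ₂F₁(1/4, 3/4; 1; 1 − 1/(2x−1)²) holds. -/

import Mathlib

open scoped Nat

/-- The Gauss hypergeometric function `₂F₁(a, b; c; x)` defined by its power
series. -/
noncomputable def hyp2F1 (a b c x : ℝ) : ℝ :=
  ∑' n : ℕ,
    ((∏ i ∈ Finset.range n, (a + i)) * (∏ i ∈ Finset.range n, (b + i)) /
      ((∏ i ∈ Finset.range n, (c + i)) * (n ! : ℝ))) * x ^ n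

/-- coefficient of the series -/
noncomputable def hypCoef (a b : ℝ) (n : ℕ) : ℝ :=
  (∏ i ∈ Finset.range n, (a + i)) * (∏ i ∈ Finset.range n, (b + i)) /
      ((∏ i ∈ Finset.range n, ((1 : ℝ) + i)) * (n ! : ℝ))

/-- termwise derivative -/
noncomputable def hypD (a b x : ℝ) : ℝ := ∑' n : ℕ, hypCoef a b n * (n * x ^ (n - 1))

/-- `x (1 - x)` times the derivative -/
noncomputable def hypQ (a b x : ℝ) : ℝ :=
  ∑' n : ℕ, a * b * hypCoef a b n / (n + 1) * x ^ (n + 1)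

lemma hypCoef_zero (a b : ℝ) : hypCoef a b 0 = 1 := by simp [hypCoef]

lemma hyp2F1_eq (a b x : ℝ) : hyp2F1 a b 1 x = ∑' n : ℕ, hypCoef a b n * x ^ n := rfl

lemma hypCoef_succ (a b : ℝ) (n : ℕ) :
    hypCoef a b (n + 1) = hypCoef a b n * ((a + n) * (b + n) / ((n + 1) * (n + 1))) := by
  unfold hypCoef
  have h1 : (∏ i ∈ Finset.range n, ((1 : ℝ) + i)) ≠ 0 :=
    Finset.prod_ne_zero_iff.mpr fun i _ => by positivity
  have h2 : (n ! : ℝ) ≠ 0 := by positivity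
  have h3 : (n : ℝ) + 1 ≠ 0 := by positivity
  rw [Finset.prod_range_succ, Finset.prod_range_succ, Finset.prod_range_succ,
    Nat.factorial_succ]
  push_cast
  rw [add_comm (1 : ℝ) (n : ℝ)]
  field_simp

lemma hypCoef_bound {a b : ℝ} (ha : 0 < a) (hb : 0 < b) (hab : a + b = 1) (n : ℕ) :
    0 ≤ hypCoef a b n ∧ hypCoef a b n ≤ 1 := by
  induction n with
  | zero => simp [hypCoef_zero]
  | succ n ih =>
    rw [hypCoef_succ]
    have h : (a + n) * (b + n) / (((n : ℝ) + 1) * (n + 1)) ≤ 1 := by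
      apply div_le_one_of_le₀ _ (by positivity)
      apply mul_le_mul <;> first | linarith | positivity
    exact ⟨mul_nonneg ih.1 (by positivity), mul_le_one₀ ih.2 (by positivity) h⟩


lemma hyp_abs {a b : ℝ} (ha : 0 < a) (hb : 0 < b) (hab : a + b = 1) (n : ℕ) :
    |hypCoef a b n| ≤ 1 := by
  have := hypCoef_bound ha hb hab n
  rw [abs_of_nonneg this.1]; exact this.2

lemma sum0 {a b : ℝ} (ha : 0 < a) (hb : 0 < b) (hab : a + b = 1) {x : ℝ} (hx : |x| < 1) :
    Summable fun n : ℕ => hypCoef a b n * x ^ n := by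
  refine Summable.of_norm_bounded (summable_geometric_of_lt_one (abs_nonneg x) hx) fun n => ?_
  rw [Real.norm_eq_abs, abs_mul, abs_pow]
  exact mul_le_of_le_one_left (by positivity) (hyp_abs ha hb hab n)

lemma sumbd {r : ℝ} (h0 : 0 ≤ r) (hr : r < 1) :
    Summable fun n : ℕ => (n : ℝ) * r ^ (n - 1) := by
  rw [← summable_nat_add_iff 1]
  have h1 := summable_pow_mul_geometric_of_norm_lt_one (R := ℝ) 1 (r := r)
    (by rwa [Real.norm_eq_abs, abs_of_nonneg h0])
  have h2 := summable_geometric_of_lt_one h0 hr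
  refine (h1.add h2).congr fun n => ?_
  simp
  ring

lemma sum1 {a b : ℝ} (ha : 0 < a) (hb : 0 < b) (hab : a + b = 1) {x : ℝ} (hx : |x| < 1) :
    Summable fun n : ℕ => hypCoef a b n * (n * x ^ (n - 1)) := by
  refine Summable.of_norm_bounded (sumbd (abs_nonneg x) hx) fun n => ?_
  rw [Real.norm_eq_abs, abs_mul, abs_mul, abs_pow, Nat.abs_cast]
  exact mul_le_of_le_one_left (by positivity) (hyp_abs ha hb hab n)

lemma hyp_hasDeriv {a b : ℝ} (ha : 0 < a) (hb : 0 < b) (hab : a + b = 1) {x : ℝ}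
    (hx : |x| < 1) : HasDerivAt (fun x => hyp2F1 a b 1 x) (hypD a b x) x := by
  obtain ⟨r, hr1, hr2⟩ := exists_between hx
  have h0 : 0 ≤ r := (abs_nonneg x).trans hr1.le
  have hpos : 0 < r := (abs_nonneg x).trans_lt hr1
  refine hasDerivAt_tsum_of_isPreconnected (t := Metric.ball (0 : ℝ) r)
    (g := fun n x => hypCoef a b n * x ^ n)
    (g' := fun n x => hypCoef a b n * (n * x ^ (n - 1))) (y₀ := 0) (sumbd h0 hr2)
    Metric.isOpen_ball (convex_ball _ _).isPreconnected ?_ ?_ (by simpa using hpos) ?_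
    (by simpa using hr1)
  · intro n y _
    exact (hasDerivAt_pow n y).const_mul _
  · intro n y hy
    have hy' : |y| ≤ r := by simpa using (Metric.mem_ball.mp hy).le
    rw [Real.norm_eq_abs, abs_mul, abs_mul, abs_pow, Nat.abs_cast]
    refine (mul_le_of_le_one_left (by positivity) (hyp_abs ha hb hab n)).trans ?_
    gcongr
  · exact sum0 ha hb hab (by simp)

lemma hypQ_hasDeriv {a b : ℝ} (ha : 0 < a) (hb : 0 < b) (hab : a + b = 1) {x : ℝ}
    (hx : |x| < 1) : HasDerivAt (fun x => hypQ a b x) (a * b * hyp2F1 a b 1 x) x := by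
  obtain ⟨r, hr1, hr2⟩ := exists_between hx
  have h0 : 0 ≤ r := (abs_nonneg x).trans hr1.le
  have hpos : 0 < r := (abs_nonneg x).trans_lt hr1
  have key : HasDerivAt (fun x => hypQ a b x) (∑' n : ℕ, a * b * (hypCoef a b n * x ^ n)) x := by
    refine hasDerivAt_tsum_of_isPreconnected (t := Metric.ball (0 : ℝ) r)
      (g := fun n x => a * b * hypCoef a b n / (n + 1) * x ^ (n + 1))
      (g' := fun n x => a * b * (hypCoef a b n * x ^ n)) (y₀ := 0)
      ((summable_geometric_of_lt_one h0 hr2).mul_left (a * b))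
      Metric.isOpen_ball (convex_ball _ _).isPreconnected ?_ ?_ (by simpa using hpos) ?_
      (by simpa using hr1)
    · intro n y _
      refine ((hasDerivAt_pow (n + 1) y).const_mul _).congr_deriv ?_
      have h3 : (n : ℝ) + 1 ≠ 0 := by positivity
      push_cast
      try simp only [Nat.add_sub_cancel]
      field_simp
    · intro n y hy
      have hy' : |y| ≤ r := by simpa using (Metric.mem_ball.mp hy).le
      rw [Real.norm_eq_abs, abs_mul, abs_mul (hypCoef a b n), abs_pow,
        abs_of_pos (mul_pos ha hb)]
      gcongr
      refine (mul_le_of_le_one_left (by positivity) (hyp_abs ha hb hab n)).trans ?_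
      gcongr
    · simp [summable_zero]
  rw [tsum_mul_left] at key
  exact key

lemma hypQ_eq {a b : ℝ} (ha : 0 < a) (hb : 0 < b) (hab : a + b = 1) {x : ℝ}
    (hx : |x| < 1) : hypQ a b x = x * (1 - x) * hypD a b x := by
  have s1 := sum1 ha hb hab hx
  have e1 : hypD a b x = ∑' n : ℕ, hypCoef a b (n + 1) * ((n + 1) * x ^ n) := by
    unfold hypD
    rw [s1.tsum_eq_zero_add]
    simp
  have s2 : Summable fun n : ℕ => hypCoef a b (n + 1) * ((n + 1) * x ^ n) := by
    have := (summable_nat_add_iff 1).mpr s1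
    simpa using this
  have : x * (1 - x) * hypD a b x = x * hypD a b x - x ^ 2 * hypD a b x := by ring
  rw [this]
  nth_rewrite 1 [e1]
  unfold hypD
  rw [← tsum_mul_left, ← tsum_mul_left, ← (s2.mul_left x).tsum_sub (s1.mul_left (x ^ 2))]
  unfold hypQ
  congr 1
  funext n
  rw [hypCoef_succ]
  have h3 : (n : ℝ) + 1 ≠ 0 := by positivity
  have hb' : b = 1 - a := by linarith
  subst hb'
  rcases n with _ | n
  · simp; ring
  · push_cast at *
    try simp only [Nat.add_sub_cancel]
    field_simp
    ring

lemma hyp_at_zero (a b : ℝ) : hyp2F1 a b 1 0 = 1 := by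
  rw [hyp2F1_eq, tsum_eq_single 0]
  · simp [hypCoef_zero]
  · intro n hn; simp [hn]

lemma hypQ_at_zero (a b : ℝ) : hypQ a b 0 = 0 := by simp [hypQ]

lemma hyp_pos {a b : ℝ} (ha : 0 < a) (hb : 0 < b) (hab : a + b = 1) {x : ℝ}
    (hx0 : 0 ≤ x) (hx : x < 1) : 0 < hyp2F1 a b 1 x := by
  have s := sum0 ha hb hab (x := x) (by rwa [abs_of_nonneg hx0])
  have := s.le_tsum 0 fun n _ => mul_nonneg (hypCoef_bound ha hb hab n).1 (pow_nonneg hx0 n)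
  rw [hyp2F1_eq]
  simp only [hypCoef_zero, pow_zero, mul_one] at this
  linarith

lemma const_of_deriv {F F' : ℝ → ℝ} {x : ℝ} (hx : 0 < x)
    (h : ∀ t ∈ Set.Icc 0 x, HasDerivAt F (F' t) t) (h0 : ∀ t ∈ Set.Ioo 0 x, F' t = 0) :
    F x = F 0 := by
  obtain ⟨c, hc, e⟩ := exists_hasDerivAt_eq_slope F F' hx
    (fun t ht => (h t ht).continuousAt.continuousWithinAt)
    (fun t ht => h t ⟨ht.1.le, ht.2.le⟩)
  rw [h0 c hc, eq_comm, div_eq_zero_iff] at e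
  rcases e with e | e <;> linarith

/-- A quadratic transformation:
`₂F₁(1/2, 1/2; 1; x) = (1 - 2x)^{-1/2} ₂F₁(1/4, 3/4; 1; 1 - 1/(2x-1)²)` on a
suitable domain. -/
theorem hyp2F1_quadratic_transform_one (x : ℝ)
    (hx0 : 0 < x) (hx1 : x < 1/2) (harg : |1 - 1 / (2*x - 1)^2| < 1) :
    hyp2F1 (1/2) (1/2) 1 x =
      (1 - 2*x) ^ (-(1/2) : ℝ) * hyp2F1 (1/4) (3/4) 1 (1 - 1 / (2*x - 1)^2) := by
  set z : ℝ → ℝ := fun t => 1 - 1 / (2*t - 1)^2 with hz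
  set v : ℝ → ℝ := fun t => √(1 - 2*t) with hv
  set f : ℝ → ℝ := fun t => hyp2F1 (1/2) (1/2) 1 t with hf
  set P : ℝ → ℝ := fun t => hypQ (1/2) (1/2) t with hP
  set H : ℝ → ℝ := fun t => hyp2F1 (1/4) (3/4) 1 (z t) with hH
  set Q : ℝ → ℝ := fun t => hypQ (1/4) (3/4) (z t) with hQ
  set D : ℝ → ℝ := fun t => hypD (1/4) (3/4) (z t) with hD
  have vpos : ∀ t ∈ Set.Icc 0 x, 0 < v t := fun t ht =>
    Real.sqrt_pos.mpr (by linarith [ht.2])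
  have vsq : ∀ t ∈ Set.Icc 0 x, t = (1 - v t ^ 2) / 2 := fun t ht => by
    have : v t ^ 2 = 1 - 2 * t := Real.sq_sqrt (by linarith [ht.2])
    linarith
  have zv : ∀ t ∈ Set.Icc 0 x, z t = 1 - 1 / v t ^ 4 := fun t ht => by
    have : v t ^ 2 = 1 - 2 * t := Real.sq_sqrt (by linarith [ht.2])
    have h4 : v t ^ 4 = (2 * t - 1) ^ 2 := by
      calc v t ^ 4 = (v t ^ 2) ^ 2 := by ring
        _ = _ := by rw [this]; ring
    rw [h4]
  have zlt : ∀ t ∈ Set.Icc 0 x, |z t| < 1 := fun t ht => by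
    have h1 : 0 < 1 - 2 * x := by linarith
    have e1 : (0 : ℝ) < (2 * t - 1) ^ 2 := by nlinarith [ht.1, ht.2]
    have e2 : (0 : ℝ) < (2 * x - 1) ^ 2 := by nlinarith
    have h2 : 1 / (2 * t - 1) ^ 2 ≤ 1 / (2 * x - 1) ^ 2 := by
      apply one_div_le_one_div_of_le e2
      nlinarith [ht.1, ht.2]
    have h3 : 0 < 1 / (2 * t - 1) ^ 2 := by positivity
    have h5 := (abs_lt.mp harg).1
    exact abs_lt.mpr ⟨by simp only [hz]; linarith, by simp only [hz]; linarith⟩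
  have tlt : ∀ t ∈ Set.Icc 0 x, |t| < 1 := fun t ht => by
    rw [abs_of_nonneg ht.1]; linarith [ht.2]
  have dv : ∀ t ∈ Set.Icc 0 x, HasDerivAt v (-1 / v t) t := fun t ht => by
    have h1 : HasDerivAt (fun t : ℝ => 1 - 2 * t) (-2) t := by
      simpa using ((hasDerivAt_id t).const_mul (2 : ℝ)).const_sub 1
    refine (h1.sqrt (by linarith [ht.2])).congr_deriv ?_
    have := vpos t ht
    simp only [hv] at this ⊢
    field_simp
    try ring
  have dz : ∀ t ∈ Set.Icc 0 x, HasDerivAt z (-4 / v t ^ 6) t := fun t ht => by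
    have h1 : HasDerivAt (fun t : ℝ => (2 * t - 1)) 2 t := by
      simpa using ((hasDerivAt_id t).const_mul (2 : ℝ)).sub_const 1
    have h0 : (2 * t - 1) ≠ 0 := by linarith [ht.2]
    have h2 := (((h1.pow 2).inv (pow_ne_zero 2 h0)).const_sub 1)
    have hvp := vpos t ht
    have e : 2 * t - 1 = - v t ^ 2 := by linarith [vsq t ht]
    have h3 : HasDerivAt z _ t := h2.congr_of_eventuallyEq (by
      filter_upwards with s
      simp [hz])
    refine h3.congr_deriv ?_
    simp only [Pi.pow_apply]
    rw [e]
    field_simp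
    try norm_num
    try ring
  have df : ∀ t ∈ Set.Icc 0 x, HasDerivAt f (hypD (1/2) (1/2) t) t := fun t ht =>
    hyp_hasDeriv (by norm_num) (by norm_num) (by norm_num) (tlt t ht)
  have dP : ∀ t ∈ Set.Icc 0 x, HasDerivAt P (1/2*(1/2) * f t) t := fun t ht =>
    hypQ_hasDeriv (by norm_num) (by norm_num) (by norm_num) (tlt t ht)
  have eP : ∀ t ∈ Set.Icc 0 x, P t = t * (1 - t) * hypD (1/2) (1/2) t := fun t ht =>
    hypQ_eq (by norm_num) (by norm_num) (by norm_num) (tlt t ht)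
  have dH : ∀ t ∈ Set.Icc 0 x, HasDerivAt H (D t * (-4 / v t ^ 6)) t := fun t ht =>
    (hyp_hasDeriv (a := 1/4) (b := 3/4) (by norm_num) (by norm_num) (by norm_num)
      (zlt t ht)).comp t (dz t ht)
  have dQ : ∀ t ∈ Set.Icc 0 x, HasDerivAt Q (1/4*(3/4) * H t * (-4 / v t ^ 6)) t :=
    fun t ht => (hypQ_hasDeriv (a := 1/4) (b := 3/4) (by norm_num) (by norm_num) (by norm_num)
      (zlt t ht)).comp t (dz t ht)
  have eQ : ∀ t ∈ Set.Icc 0 x, Q t = z t * (1 - z t) * D t := fun t ht =>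
    hypQ_eq (by norm_num) (by norm_num) (by norm_num) (zlt t ht)
  have fpos : ∀ t ∈ Set.Icc 0 x, 0 < f t := fun t ht =>
    hyp_pos (by norm_num) (by norm_num) (by norm_num) ht.1 (by linarith [ht.2])
  set g : ℝ → ℝ := fun t => H t / v t with hg
  set R : ℝ → ℝ := fun t => ((v t ^ 3)⁻¹ - v t) / 4 * H t + v t * Q t with hR
  have dg : ∀ t ∈ Set.Icc 0 x, HasDerivAt g (H t / v t ^ 3 - 4 * D t / v t ^ 7) t :=
    fun t ht => by
      have := vpos t ht
      refine ((dH t ht).div (dv t ht) this.ne').congr_deriv ?_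
      field_simp
      try ring
  have eR : ∀ t ∈ Set.Icc 0 x,
      R t = t * (1 - t) * (H t / v t ^ 3 - 4 * D t / v t ^ 7) := fun t ht => by
    have := vpos t ht
    have e : t * (1 - t) = (1 - v t ^ 4) / 4 := by
      have h := vsq t ht
      have h' : v t ^ 2 = 1 - 2 * t := by linarith
      have : v t ^ 4 = (v t ^ 2) ^ 2 := by ring
      rw [this, h']; ring
    rw [e]
    simp only [hR]
    rw [eQ t ht, zv t ht]
    field_simp
    ring
  have dR : ∀ t ∈ Set.Icc 0 x, HasDerivAt R (g t / 4) t := fun t ht => by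
    have hp := vpos t ht
    have h3 := ((dv t ht).pow 3).inv (pow_ne_zero 3 hp.ne')
    have := ((((h3.sub (dv t ht)).div_const 4).mul (dH t ht)).add ((dv t ht).mul (dQ t ht)))
    refine HasDerivAt.congr_deriv (f := R) this ?_
    simp only [hg, Pi.pow_apply, Pi.sub_apply, Pi.inv_apply]
    rw [eQ t ht, zv t ht]
    field_simp
    ring
  have z0 : z 0 = 0 := by simp [hz]
  have v0 : v 0 = 1 := by simp [hv]
  have H0 : H 0 = 1 := by simp only [hH, z0]; exact hyp_at_zero _ _
  have Q0 : Q 0 = 0 := by simp only [hQ, z0]; exact hypQ_at_zero _ _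
  have f0 : f 0 = 1 := hyp_at_zero _ _
  have P0 : P 0 = 0 := hypQ_at_zero _ _
  have W : ∀ t ∈ Set.Ioo 0 x, f t * R t - P t * g t = 0 := fun t ht => by
    have sub : ∀ s ∈ Set.Icc 0 t, s ∈ Set.Icc 0 x := fun s hs => ⟨hs.1, hs.2.trans ht.2.le⟩
    have := const_of_deriv (F := fun t => f t * R t - P t * g t) ht.1
      (fun s hs => ((df s (sub s hs)).mul (dR s (sub s hs))).sub
        ((dP s (sub s hs)).mul (dg s (sub s hs)))) (fun s hs => by
          have hs' := sub s ⟨hs.1.le, hs.2.le⟩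
          rw [eR s hs', eP s hs']
          ring)
    try simp only at this
    rw [this, P0, f0]
    simp [hR, v0, Q0]
  have fin := const_of_deriv (F := fun t => g t / f t) hx0
    (fun s hs => (dg s hs).div (df s hs) (fpos s hs).ne') (fun s hs => by
      have hs' : s ∈ Set.Icc 0 x := ⟨hs.1.le, hs.2.le⟩
      have w := W s hs
      rw [eR s hs', eP s hs'] at w
      have hp : s * (1 - s) ≠ 0 := by
        have := hs.1
        have := hs.2
        apply mul_ne_zero <;> linarith
      rw [div_eq_zero_iff]
      left
      apply mul_left_cancel₀ hp
      linarith)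
  simp only [f0] at fin
  have hxm : x ∈ Set.Icc 0 x := ⟨hx0.le, le_rfl⟩
  rw [div_eq_iff (fpos x hxm).ne'] at fin
  simp only [hg, H0, v0] at fin
  have hrp : (1 - 2*x) ^ (-(1/2) : ℝ) = (v x)⁻¹ := by
    rw [Real.rpow_neg (by linarith), ← Real.sqrt_eq_rpow]
  rw [hrp]
  have : H x / v x = f x := by simpa using fin
  change f x = (v x)⁻¹ * H x
  rw [← this]; ring
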